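/- Let G be a finite simple graph, u ≠ v two vertices, and C a set of vertices with u, v ∉ C such that every edge of G with an endpoint in C has its other endpoint in C ∪ {u, v} ({u,v} is a separator cutting off C). If α(G[C ∪ {u, v}]) = α(G[C]) + 2, then α(G) = α(G[C]) + α(G[V \ C]). -/

import Mathlib

/-- A set of vertices is independent if its elements are pairwise non-adjacent. -/
def IsIndepSet {V : Type*} (G : SimpleGraph V) (s : Set V) : Prop :=
  s.Pairwise fun a b => ¬ G.Adj a b

/-- A finset of vertices is a maximum independent set if it is independent and of
maximum cardinality among independent sets. -/
def IsMaxIndepSet {V : Type*} (G : SimpleGraph V) (I : Finset V) : Prop :=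
  IsIndepSet G ↑I ∧ ∀ J : Finset V, IsIndepSet G ↑J → J.card ≤ I.card

/-- The independence number of a graph: the maximum cardinality of an independent set. -/
noncomputable def indepNum {V : Type*} (G : SimpleGraph V) : ℕ :=
  sSup {n | ∃ s : Finset V, IsIndepSet G ↑s ∧ s.card = n}

theorem indep_card_le {V : Type*} [Finite V] (G : SimpleGraph V) (s : Finset V)
    (hs : IsIndepSet G ↑s) : s.card ≤ indepNum G := by
  have := Fintype.ofFinite V
  refine le_csSup ⟨Fintype.card V, ?_⟩ ⟨s, hs, rfl⟩
  rintro n ⟨t, -, rfl⟩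
  exact t.card_le_univ

theorem indep_exists {V : Type*} [Finite V] (G : SimpleGraph V) :
    ∃ s : Finset V, IsIndepSet G ↑s ∧ s.card = indepNum G := by
  have := Fintype.ofFinite V
  refine Nat.sSup_mem (s := {n | ∃ s : Finset V, IsIndepSet G ↑s ∧ s.card = n}) ?_ ?_
  · exact ⟨0, ∅, by simp [IsIndepSet], rfl⟩
  · refine ⟨Fintype.card V, ?_⟩
    rintro n ⟨t, -, rfl⟩
    exact t.card_le_univ

theorem induce_card_le {V : Type*} [Finite V] (G : SimpleGraph V) (A : Set V) (s : Finset V)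
    (hs : IsIndepSet G ↑s) (hA : ∀ x ∈ s, x ∈ A) : s.card ≤ indepNum (G.induce A) := by
  classical
  have h := indep_card_le (G.induce A) (s.subtype (· ∈ A)) (by
    intro a ha b hb hab
    simp only [Finset.mem_coe, Finset.mem_subtype] at ha hb
    exact hs ha hb (fun h => hab (Subtype.ext h)))
  rwa [Finset.card_subtype, Finset.filter_true_of_mem hA] at h

theorem induce_exists {V : Type*} [Finite V] (G : SimpleGraph V) (A : Set V) :
    ∃ s : Finset V, IsIndepSet G ↑s ∧ (∀ x ∈ s, x ∈ A) ∧ s.card = indepNum (G.induce A) := by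
  obtain ⟨s, hs, hc⟩ := indep_exists (G.induce A)
  refine ⟨s.map (Function.Embedding.subtype _), ?_, ?_, by rw [Finset.card_map, hc]⟩
  · intro a ha b hb hab
    simp only [Finset.coe_map, Set.mem_image, Finset.mem_coe] at ha hb
    obtain ⟨x, hx, rfl⟩ := ha
    obtain ⟨y, hy, rfl⟩ := hb
    exact hs hx hy (fun h => hab (by rw [h]))
  · intro x hx
    obtain ⟨y, -, rfl⟩ := Finset.mem_map.1 hx
    exact y.2

/-- Two-separator rule: if {u, v} cuts off C and α(G[C ∪ {u, v}]) = α(G[C]) + 2,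
then α(G) = α(G[C]) + α(G[V \ C]). -/
theorem two_separator_plus_two {V : Type*} [Fintype V] [DecidableEq V]
    (G : SimpleGraph V) (u v : V) (huv : u ≠ v) (C : Set V) (hu : u ∉ C) (hv : v ∉ C)
    (hsep : ∀ a b : V, G.Adj a b → a ∈ C → b ∈ C ∪ {u, v})
    (halpha : indepNum (G.induce (C ∪ {u, v})) = indepNum (G.induce C) + 2) :
    indepNum G = indepNum (G.induce C) + indepNum (G.induce (Cᶜ : Set V)) := by
  classical
  apply le_antisymm
  · obtain ⟨s, hs, hc⟩ := indep_exists G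
    have h1 := induce_card_le G C (s.filter (· ∈ C))
      (hs.mono (Finset.coe_subset.2 (Finset.filter_subset _ _))) (by simp)
    have h2 := induce_card_le G Cᶜ (s.filter (· ∉ C))
      (hs.mono (Finset.coe_subset.2 (Finset.filter_subset _ _))) (by simp)
    have h3 := Finset.card_filter_add_card_filter_not (s := s) (· ∈ C)
    omega
  · obtain ⟨s, hs, hA, hc⟩ := induce_exists G (C ∪ {u, v})
    obtain ⟨J, hJ, hJC, hJc⟩ := induce_exists G Cᶜ
    have h1 := induce_card_le G C (s.filter (· ∈ C))
      (hs.mono (Finset.coe_subset.2 (Finset.filter_subset _ _))) (by simp)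
    have h3 := Finset.card_filter_add_card_filter_not (s := s) (· ∈ C)
    have hsub : s.filter (· ∉ C) ⊆ {u, v} := by
      intro x hx
      rw [Finset.mem_filter] at hx
      have := hA x hx.1
      simp only [Set.mem_union, Set.mem_insert_iff, Set.mem_singleton_iff] at this
      simp only [Finset.mem_insert, Finset.mem_singleton]
      tauto
    have hcard : ({u, v} : Finset V).card = 2 := Finset.card_pair huv
    have h4 := Finset.card_le_card hsub
    have heq := Finset.eq_of_subset_of_card_le hsub (by omega)
    have hus : u ∈ s := (Finset.mem_filter.1 (heq ▸ (by simp : u ∈ ({u, v} : Finset V)))).1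
    have hvs : v ∈ s := (Finset.mem_filter.1 (heq ▸ (by simp : v ∈ ({u, v} : Finset V)))).1
    have hcross : ∀ a ∈ s, a ∈ C → ∀ b ∈ J, ¬ G.Adj a b := by
      intro a ha haC b hb hab
      have hbC : b ∉ C := hJC b hb
      have hne : a ≠ b := fun h => hbC (h ▸ haC)
      rcases hsep a b hab haC with h | h | h
      · exact hbC h
      · subst h; exact hs ha hus hne hab
      · have h : b = v := h
        subst h; exact hs ha hvs hne hab
    have hfin := indep_card_le G (s.filter (· ∈ C) ∪ J) (by
      intro a ha b hb hne hab
      simp only [Finset.coe_union, Set.mem_union, Finset.mem_coe, Finset.mem_filter] at ha hb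
      rcases ha with ⟨ha, haC⟩ | ha <;> rcases hb with ⟨hb, hbC⟩ | hb
      · exact hs ha hb hne hab
      · exact hcross a ha haC b hb hab
      · exact hcross b hb hbC a ha hab.symm
      · exact hJ ha hb hne hab)
    have hdis : Disjoint (s.filter (· ∈ C)) J := by
      rw [Finset.disjoint_left]
      intro x hx hxJ
      exact hJC x hxJ (Finset.mem_filter.1 hx).2
    rw [Finset.card_union_of_disjoint hdis] at hfin
    omega
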